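/- arXiv:1710.09285 — 3 statements merged into one kernel-verified Lean document; each statement's English description precedes it below -/
import Mathlib

section
/- Let Y be a random vector in ℝ^n with the multivariate Normal distribution 𝔑_n(μ, D), and let S : ℝ^n → ℝ^m and T : ℝ^n → ℝ^p be linear maps. Then the random vectors S Y and T Y are independent if and only if S D T* : ℝ^p → ℝ^m is the zero operator (equivalently, T D S* is the zero operator). -/
open MeasureTheory ProbabilityTheory
open scoped RealInnerProductSpace

/-- The bilinear form `⟪S* a, D T* b⟫` vanishes exactly when the operator `S D T*` does. -/
lemma LinearMap.comp_comp_adjoint_eq_zero_iff {E F G : Type*}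
    [NormedAddCommGroup E] [InnerProductSpace ℝ E] [FiniteDimensional ℝ E]
    [NormedAddCommGroup F] [InnerProductSpace ℝ F] [FiniteDimensional ℝ F]
    [NormedAddCommGroup G] [InnerProductSpace ℝ G] [FiniteDimensional ℝ G]
    (D : E →ₗ[ℝ] E) (S : E →ₗ[ℝ] F) (T : E →ₗ[ℝ] G) :
    S ∘ₗ D ∘ₗ LinearMap.adjoint T = 0 ↔
      ∀ a b, ⟪LinearMap.adjoint S a, D (LinearMap.adjoint T b)⟫ = 0 := by
  simp only [LinearMap.adjoint_inner_left]
  refine ⟨fun h a b ↦ ?_, fun h ↦ LinearMap.ext fun b ↦ ?_⟩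
  · have := LinearMap.congr_fun h b
    simp only [LinearMap.comp_apply, LinearMap.zero_apply] at this
    rw [this, inner_zero_right]
  · exact inner_self_eq_zero.mp (h _ b)

/-- Characteristic function of the image under `S` of a random vector `Y`. -/
lemma charFun_map_linearMap_comp {Ω E F : Type*} [MeasurableSpace Ω] {P : Measure Ω}
    [NormedAddCommGroup E] [InnerProductSpace ℝ E] [FiniteDimensional ℝ E]
    [MeasurableSpace E] [BorelSpace E]
    [NormedAddCommGroup F] [InnerProductSpace ℝ F] [FiniteDimensional ℝ F]
    [MeasurableSpace F] [BorelSpace F]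
    {Y : Ω → E} (hY : Measurable Y) (S : E →ₗ[ℝ] F) (a : F) :
    charFun (P.map (fun ω ↦ S (Y ω))) a =
      ∫ ω, Complex.exp (⟪LinearMap.adjoint S a, Y ω⟫ * Complex.I) ∂P := by
  have hS : Measurable fun ω ↦ S (Y ω) := S.continuous_of_finiteDimensional.measurable.comp hY
  rw [charFun_apply, integral_map hS.aemeasurable (by fun_prop)]
  simp only [LinearMap.adjoint_inner_left, real_inner_comm]

/-- Factorization of Gaussian characteristic functions amounts to orthogonality for the
covariance form. -/
lemma exp_gaussian_add_eq_mul_iff {E : Type*} [NormedAddCommGroup E] [InnerProductSpace ℝ E]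
    {D : E →ₗ[ℝ] E} (hD : D.IsSymmetric) (μ u v : E) :
    Complex.exp (⟪u + v, μ⟫ * Complex.I - ⟪u + v, D (u + v)⟫ / 2) =
        Complex.exp (⟪u, μ⟫ * Complex.I - ⟪u, D u⟫ / 2) *
          Complex.exp (⟪v, μ⟫ * Complex.I - ⟪v, D v⟫ / 2) ↔
      ⟪u, D v⟫ = 0 := by
  have hvu : ⟪v, D u⟫ = ⟪u, D v⟫ := by rw [← hD, real_inner_comm]
  have hadd : ⟪u + v, D (u + v)⟫ = ⟪u, D u⟫ + ⟪v, D v⟫ + 2 * ⟪u, D v⟫ := by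
    rw [map_add, inner_add_left, inner_add_right, inner_add_right, hvu]
    ring
  rw [hadd, inner_add_left, ← Complex.exp_add]
  refine ⟨fun h ↦ ?_, fun h ↦ ?_⟩
  · have hre := congrArg norm h
    rw [Complex.norm_exp, Complex.norm_exp] at hre
    have := Real.exp_injective hre
    norm_num at this
    linarith
  · rw [h]
    congr 1
    push_cast
    ring

/-- **Corollary 1.** Let `Y ∼ 𝔑ₙ(μ, D)` and let `S : ℝⁿ → ℝᵐ`, `T : ℝⁿ → ℝᵖ` be
linear maps. Then `S Y` and `T Y` are independent if and only if `S D T* : ℝᵖ → ℝᵐ` is the zero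
operator (equivalently, `T D S*` is the zero operator). -/
theorem indepFun_linear_images_iff
    {Ω : Type*} [MeasurableSpace Ω] (P : Measure Ω) [IsProbabilityMeasure P]
    (n m p : ℕ) (Y : Ω → EuclideanSpace ℝ (Fin n)) (hYmeas : Measurable Y)
    (μ : EuclideanSpace ℝ (Fin n))
    (D : EuclideanSpace ℝ (Fin n) →ₗ[ℝ] EuclideanSpace ℝ (Fin n))
    (hDsym : LinearMap.IsSymmetric D) (hDpos : ∀ t, 0 ≤ ⟪D t, t⟫)
    (hY : ∀ t : EuclideanSpace ℝ (Fin n),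
      ∫ ω, Complex.exp (⟪t, Y ω⟫ * Complex.I) ∂P
        = Complex.exp (⟪t, μ⟫ * Complex.I - ⟪t, D t⟫ / 2))
    (S : EuclideanSpace ℝ (Fin n) →ₗ[ℝ] EuclideanSpace ℝ (Fin m))
    (T : EuclideanSpace ℝ (Fin n) →ₗ[ℝ] EuclideanSpace ℝ (Fin p)) :
    (IndepFun (fun ω => S (Y ω)) (fun ω => T (Y ω)) P ↔
        S ∘ₗ D ∘ₗ LinearMap.adjoint T = 0) ∧
    (S ∘ₗ D ∘ₗ LinearMap.adjoint T = 0 ↔ T ∘ₗ D ∘ₗ LinearMap.adjoint S = 0) := by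
  have hS : Measurable fun ω ↦ S (Y ω) :=
    S.continuous_of_finiteDimensional.measurable.comp hYmeas
  have hT : Measurable fun ω ↦ T (Y ω) :=
    T.continuous_of_finiteDimensional.measurable.comp hYmeas
  have hpair (t : WithLp 2 (EuclideanSpace ℝ (Fin m) × EuclideanSpace ℝ (Fin p))) :
      charFun (P.map fun ω ↦ WithLp.toLp 2 (S (Y ω), T (Y ω))) t =
        ∫ ω, Complex.exp
          (⟪LinearMap.adjoint S t.ofLp.1 + LinearMap.adjoint T t.ofLp.2, Y ω⟫ * Complex.I) ∂P := by
    rw [charFun_apply, integral_map (by fun_prop) (by fun_prop)]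
    simp only [inner_add_left, LinearMap.adjoint_inner_left, WithLp.prod_inner_apply,
      real_inner_comm]
  constructor
  · rw [indepFun_iff_charFun_prod hS.aemeasurable hT.aemeasurable,
      LinearMap.comp_comp_adjoint_eq_zero_iff]
    simp only [hpair, charFun_map_linearMap_comp hYmeas, hY, exp_gaussian_add_eq_mul_iff hDsym]
    exact ⟨fun h a b ↦ h (WithLp.toLp 2 (a, b)), fun h t ↦ h t.ofLp.1 t.ofLp.2⟩
  · rw [LinearMap.comp_comp_adjoint_eq_zero_iff, LinearMap.comp_comp_adjoint_eq_zero_iff,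
      forall_comm]
    simp only [← hDsym _ (LinearMap.adjoint T _), real_inner_comm]
end

section
/- Let T : ℝ^n → ℝ^m be a linear map and let T* : ℝ^m → ℝ^n be its adjoint. Then the σ-algebra on ℝ^n generated by T (the comap of the Borel σ-algebra of ℝ^m under T) equals the σ-algebra generated by the operator T* ∘ T : ℝ^n → ℝ^n (the comap of the Borel σ-algebra of ℝ^n under T* ∘ T). Consequently, for any random vector Y in ℝ^n, σ(T Y) = σ((T* T) Y). -/
open MeasureTheory

theorem LinearMap.exists_comp_eq_of_ker_le {K V W U : Type*} [DivisionRing K]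
    [AddCommGroup V] [Module K V] [AddCommGroup W] [Module K W] [AddCommGroup U] [Module K U]
    (f : V →ₗ[K] W) (g : V →ₗ[K] U) (h : LinearMap.ker f ≤ LinearMap.ker g) :
    ∃ l : W →ₗ[K] U, l ∘ₗ f = g := by
  obtain ⟨l, hl⟩ := ((LinearMap.ker f).liftQ f le_rfl).exists_leftInverse_of_injective
    (Submodule.ker_liftQ_eq_bot _ _ _ le_rfl)
  refine ⟨(LinearMap.ker f).liftQ g h ∘ₗ l, LinearMap.ext fun x => ?_⟩
  have hx : l (f x) = (LinearMap.ker f).mkQ x := LinearMap.congr_fun hl ((LinearMap.ker f).mkQ x)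
  simp [hx]

/-- A linear map whose kernel contains that of `f` generates a coarser σ-algebra than `f`. -/
theorem LinearMap.comap_borel_le_of_ker_le {V W U : Type*} [AddCommGroup V] [Module ℝ V]
    [NormedAddCommGroup W] [NormedSpace ℝ W] [FiniteDimensional ℝ W]
    [MeasurableSpace W] [BorelSpace W]
    [NormedAddCommGroup U] [NormedSpace ℝ U] [MeasurableSpace U] [BorelSpace U]
    (f : V →ₗ[ℝ] W) (g : V →ₗ[ℝ] U) (h : LinearMap.ker f ≤ LinearMap.ker g) :
    MeasurableSpace.comap g inferInstance ≤ MeasurableSpace.comap f inferInstance := by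
  obtain ⟨l, rfl⟩ := f.exists_comp_eq_of_ker_le g h
  rw [LinearMap.coe_comp, ← MeasurableSpace.comap_comp]
  exact MeasurableSpace.comap_mono l.continuous_of_finiteDimensional.measurable.comap_le

/-- Let `T : ℝⁿ → ℝᵐ` be a linear map and `T*` its adjoint. Then the
σ-algebra on `ℝⁿ` generated by `T` (the comap of the Borel σ-algebra under `T`) equals the
σ-algebra generated by `T* ∘ T : ℝⁿ → ℝⁿ`. Consequently, for any random vector `Y` in `ℝⁿ`,
`σ(T Y) = σ((T* T) Y)`. -/
theorem comap_linear_eq_comap_adjoint_comp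
    (n m : ℕ) (T : EuclideanSpace ℝ (Fin n) →ₗ[ℝ] EuclideanSpace ℝ (Fin m)) :
    (MeasurableSpace.comap T (inferInstance : MeasurableSpace (EuclideanSpace ℝ (Fin m)))
        = MeasurableSpace.comap (LinearMap.adjoint T ∘ₗ T)
            (inferInstance : MeasurableSpace (EuclideanSpace ℝ (Fin n)))) ∧
    (∀ (Ω : Type) (Y : Ω → EuclideanSpace ℝ (Fin n)),
      MeasurableSpace.comap (fun ω => T (Y ω))
          (inferInstance : MeasurableSpace (EuclideanSpace ℝ (Fin m)))
        = MeasurableSpace.comap (fun ω => LinearMap.adjoint T (T (Y ω)))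
            (inferInstance : MeasurableSpace (EuclideanSpace ℝ (Fin n)))) := by
  have hker := LinearMap.ker_adjoint_comp_self T
  have key := le_antisymm
    (LinearMap.comap_borel_le_of_ker_le (LinearMap.adjoint T ∘ₗ T) T hker.le)
    (LinearMap.comap_borel_le_of_ker_le T (LinearMap.adjoint T ∘ₗ T) hker.ge)
  refine ⟨key, fun Ω Y => ?_⟩
  have hY := congrArg (MeasurableSpace.comap Y) key
  rwa [MeasurableSpace.comap_comp, MeasurableSpace.comap_comp] at hY
end

section
/- Let n ≥ 3 and let W = (X, Y, Z) be a random vector with the multivariate Normal distribution on ℝ^n, where X, Y are real-valued and Z takes values in ℝ^{n−2}. Then almost surely E(Y | X, Z) − E(Y | Z) = (Cov(X, Y | Z) / Var(X | Z)) · 1[Var(X|Z) > 0] · (X − E(X | Z)), where Cov(X, Y | Z) = E[(X − E(X|Z))(Y − E(Y|Z)) | Z], Var(X | Z) = Cov(X, X | Z), and the right-hand side is interpreted as 0 on the event Var(X|Z) = 0. -/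
open MeasureTheory ProbabilityTheory
open scoped RealInnerProductSpace

namespace MeasureTheory

variable {Ω : Type*} {mΩ : MeasurableSpace Ω} {P : Measure Ω}

/-- A square-integrable random variable has a linear regression on a finite family. -/
lemma MemLp.exists_covariance_sub_sum_eq_zero [IsProbabilityMeasure P] {ι : Type*} [Fintype ι]
    {f : Ω → ℝ} {g : ι → Ω → ℝ} (hf : MemLp f 2 P) (hg : ∀ i, MemLp (g i) 2 P) :
    ∃ a : ι → ℝ, ∀ j, cov[fun ω ↦ f ω - ∑ i, a i * g i ω, g j; P] = 0 := by
  have hfc : MemLp (fun ω ↦ f ω - P[f]) 2 P := hf.sub (memLp_const _)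
  have hgc (i) : MemLp (fun ω ↦ g i ω - P[g i]) 2 P := (hg i).sub (memLp_const _)
  let F : Lp ℝ 2 P := hfc.toLp _
  let G : ι → Lp ℝ 2 P := fun i ↦ (hgc i).toLp _
  let S : Submodule ℝ (Lp ℝ 2 P) := Submodule.span ℝ (Set.range G)
  have : FiniteDimensional ℝ S := FiniteDimensional.span_of_finite ℝ (Set.finite_range G)
  obtain ⟨a, ha⟩ := (Submodule.mem_span_range_iff_exists_fun ℝ).1 (S.starProjection_apply_mem F)
  refine ⟨a, fun j ↦ ?_⟩
  have horth : inner ℝ (F - ∑ i, a i • G i) (G j) = 0 := by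
    rw [ha]
    exact S.starProjection_inner_eq_zero F _ (Submodule.subset_span ⟨j, rfl⟩)
  have hcov {u v : Ω → ℝ} (hu : MemLp (fun ω ↦ u ω - P[u]) 2 P)
      (hv : MemLp (fun ω ↦ v ω - P[v]) 2 P) : inner ℝ (hu.toLp _) (hv.toLp _) = cov[u, v; P] := by
    rw [L2.inner_def, covariance]
    refine integral_congr_ae ?_
    filter_upwards [hu.coeFn_toLp, hv.coeFn_toLp] with ω h1 h2
    rw [h1, h2, real_inner_comm]
    simp
  have hsum : MemLp (fun ω ↦ ∑ i, a i * g i ω) 2 P :=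
    memLp_finsetSum _ fun i _ ↦ (hg i).const_mul _
  have hsub := covariance_fun_sub_left hf hsum (hg j)
  rw [hsub, covariance_fun_sum_left (fun i ↦ (hg i).const_mul (a i)) (hg j)]
  simpa only [inner_sub_left, sum_inner, real_inner_smul_left, F, G, hcov,
    covariance_const_mul_left] using horth

/-- The conditional expectation of the sum of a variable measurable with respect to `V`
and a variable independent of `V`. -/
lemma condExp_add_of_indepFun [IsProbabilityMeasure P] {E : Type*} [mE : MeasurableSpace E]
    {h R : Ω → ℝ} {V : Ω → E} (hV : Measurable V) (hh : Measurable[mE.comap V] h)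
    (hhi : Integrable h P) (hR : Measurable R) (hRi : Integrable R P) (hRV : IndepFun R V P) :
    P[fun ω ↦ h ω + R ω | mE.comap V] =ᵐ[P] fun ω ↦ h ω + P[R] := by
  have h1 := condExp_add hhi hRi (mE.comap V)
  have h2 := condExp_of_stronglyMeasurable hV.comap_le hh.stronglyMeasurable hhi
  have h3 := condExp_indep_eq hR.comap_le hV.comap_le
    (comap_measurable R).stronglyMeasurable hRV
  filter_upwards [h1, h3] with ω e1 e3
  change (P[h + R | mE.comap V]) ω = _
  rw [e1, Pi.add_apply, h2, e3]

end MeasureTheory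

namespace ProbabilityTheory

variable {Ω : Type*} {mΩ : MeasurableSpace Ω} {P : Measure Ω}

/-- A random vector with a Gaussian characteristic function has a Gaussian law. -/
lemma hasGaussianLaw_of_integral_cexp_eq [IsProbabilityMeasure P] {E : Type*}
    [NormedAddCommGroup E] [InnerProductSpace ℝ E] [FiniteDimensional ℝ E] [MeasurableSpace E]
    [BorelSpace E] {W : Ω → E} (hWm : AEMeasurable W P) (m : E) (D : E →ₗ[ℝ] E)
    (hDsym : D.IsSymmetric) (hDpos : ∀ t, 0 ≤ ⟪D t, t⟫)
    (hW : ∀ t, ∫ ω, Complex.exp (⟪t, W ω⟫ * Complex.I) ∂P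
      = Complex.exp (⟪t, m⟫ * Complex.I - ⟪t, D t⟫ / 2)) :
    HasGaussianLaw W P where
  isGaussian_map := by
    have := FiniteDimensional.complete ℝ E
    have : IsProbabilityMeasure (P.map W) := Measure.isProbabilityMeasure_map hWm
    let B : E →L[ℝ] E →L[ℝ] ℝ := (innerSL ℝ).flip.comp D.toContinuousLinearMap
    have hB (s t : E) : B s t = ⟪t, D s⟫ := rfl
    refine isGaussian_iff_gaussian_charFun.2 ⟨m, B, ⟨⟨fun s t ↦ ?_⟩, ⟨fun t ↦ ?_⟩⟩, fun t ↦ ?_⟩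
    · change ⟪t, D s⟫ = ⟪s, D t⟫
      rw [real_inner_comm, hDsym]
    · change 0 ≤ ⟪t, D t⟫
      rw [real_inner_comm]
      exact hDpos t
    · rw [charFun_apply, integral_map hWm (by fun_prop), hB, ← hW]
      simp_rw [real_inner_comm]

/-- The "partial out" formula for jointly Gaussian random variables. -/
theorem HasGaussianLaw.condExp_sub_condExp_ae_eq [IsProbabilityMeasure P] {ι : Type*} [Fintype ι]
    {X Y : Ω → ℝ} {Z : Ω → ι → ℝ} (hX : Measurable X) (hY : Measurable Y) (hZ : Measurable Z)
    (h : HasGaussianLaw (fun ω ↦ (X ω, Y ω, Z ω)) P) (mZ mXZ : MeasurableSpace Ω)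
    (hmZ : mZ = MeasurableSpace.comap Z inferInstance)
    (hmXZ : mXZ = MeasurableSpace.comap (fun ω ↦ (X ω, Z ω)) inferInstance) :
    ∀ᵐ ω ∂P,
      (P[Y | mXZ]) ω - (P[Y | mZ]) ω
        = if 0 < (P[fun ω' => (X ω' - (P[X | mZ]) ω') ^ 2 | mZ]) ω then
            ((P[fun ω' => (X ω' - (P[X | mZ]) ω') * (Y ω' - (P[Y | mZ]) ω') | mZ]) ω
                / (P[fun ω' => (X ω' - (P[X | mZ]) ω') ^ 2 | mZ]) ω)
              * (X ω - (P[X | mZ]) ω)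
          else 0 := by
  subst hmZ hmXZ
  have hX2 : MemLp X 2 P := h.fst.memLp_two
  have hY2 : MemLp Y 2 P := h.snd.fst.memLp_two
  have hZ2 (i : ι) : MemLp (fun ω ↦ Z ω i) 2 P := (h.snd.snd.eval i).memLp_two
  have hZi (i : ι) : Measurable (fun ω ↦ Z ω i) := (measurable_pi_apply i).comp hZ
  obtain ⟨a, ha⟩ := hX2.exists_covariance_sub_sum_eq_zero hZ2
  obtain ⟨b, hb⟩ := hY2.exists_covariance_sub_sum_eq_zero hZ2
  -- the linear parts and the residuals of the regressions of `X` and `Y` on `Z`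
  let A : Ω → ℝ := fun ω ↦ ∑ i, a i * Z ω i
  let B : Ω → ℝ := fun ω ↦ ∑ i, b i * Z ω i
  let U : Ω → ℝ := fun ω ↦ X ω - A ω
  let V : Ω → ℝ := fun ω ↦ Y ω - B ω
  let β : ℝ := cov[U, V; P] / Var[U; P]
  let R : Ω → ℝ := fun ω ↦ V ω - β * U ω
  have hA2 : MemLp A 2 P := memLp_finsetSum _ fun i _ ↦ (hZ2 i).const_mul _
  have hB2 : MemLp B 2 P := memLp_finsetSum _ fun i _ ↦ (hZ2 i).const_mul _
  have hU2 : MemLp U 2 P := hX2.sub hA2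
  have hV2 : MemLp V 2 P := hY2.sub hB2
  have hR2 : MemLp R 2 P := hV2.sub (hU2.const_mul _)
  have hAm : Measurable A := by fun_prop
  have hBm : Measurable B := by fun_prop
  have hUm : Measurable U := hX.sub hAm
  have hVm : Measurable V := hY.sub hBm
  have hRm : Measurable R := by fun_prop
  have hRZ (i : ι) : cov[R, fun ω ↦ Z ω i; P] = 0 := by
    have := covariance_fun_sub_left hV2 (hU2.const_mul β) (hZ2 i)
    rw [this, covariance_const_mul_left, ha, hb]
    simp
  have hβ : β * Var[U; P] = cov[U, V; P] := by
    by_cases hv : Var[U; P] = 0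
    · have : cov[U, V; P] = 0 := by
        have hU : U =ᵐ[P] fun _ ↦ P[U] :=
          ae_eq_integral_of_variance_eq_zero hU2 hv
        refine integral_eq_zero_of_ae ?_
        filter_upwards [hU] with ω hω
        simp [hω]
      rw [hv, this, mul_zero]
    · exact div_mul_cancel₀ _ hv
  have hRU : cov[R, U; P] = 0 := by
    have := covariance_fun_sub_left hV2 (hU2.const_mul β) hU2
    rw [this, covariance_const_mul_left, covariance_self hUm.aemeasurable, hβ, covariance_comm,
      sub_self]
  have hRX : cov[R, X; P] = 0 := by
    have hXe : X = fun ω ↦ U ω + A ω := by ext ω; simp [U]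
    have hAe : cov[R, A; P] = 0 := by
      have := covariance_fun_sum_right (μ := P) (fun i ↦ (hZ2 i).const_mul (a i)) hR2
      simp_rw [A, this, covariance_const_mul_right, hRZ]
      simp
    rw [hXe]
    have := covariance_add_right hR2 hU2 hA2
    change cov[R, U + A; P] = 0
    rw [this, hRU, hAe, add_zero]
  let x : ℝ × ℝ × (ι → ℝ) →L[ℝ] ℝ := .fst ℝ _ _
  let y : ℝ × ℝ × (ι → ℝ) →L[ℝ] ℝ := (ContinuousLinearMap.fst ℝ _ _).comp (.snd ℝ _ _)
  let z (i : ι) : ℝ × ℝ × (ι → ℝ) →L[ℝ] ℝ :=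
    (ContinuousLinearMap.proj i).comp ((ContinuousLinearMap.snd ℝ _ _).comp (.snd ℝ _ _))
  let u := x - ∑ i, a i • z i
  let v := y - ∑ i, b i • z i
  have hUVZ : IndepFun (fun ω ↦ (U ω, V ω)) Z P := by
    have hG : HasGaussianLaw
        (fun ω ↦ ((fun k ↦ (![U, V] : Fin 2 → Ω → ℝ) k ω), fun i ↦ Z ω i)) P := by
      refine (h.map_fun ((ContinuousLinearMap.pi ![u, v]).prod (.pi z))).congr (.of_forall fun ω ↦
        Prod.ext (funext fun k ↦ ?_) rfl)
      fin_cases k <;> simp [U, V, A, B, u, v, x, y, z]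
    have := hG.indepFun_of_covariance_eval fun k i ↦ by fin_cases k; exacts [ha i, hb i]
    exact this.comp (φ := fun f ↦ (f 0, f 1)) (by fun_prop) measurable_id
  have hRXZ : IndepFun R (fun ω ↦ (X ω, Z ω)) P := by
    let XZ : Option ι → Ω → ℝ := fun o ↦ o.elim X fun i ω ↦ Z ω i
    have hG : HasGaussianLaw (fun ω ↦ ((fun _ : Unit ↦ R ω), fun o ↦ XZ o ω)) P := by
      refine (h.map_fun ((ContinuousLinearMap.pi fun _ : Unit ↦ v - β • u).prod
        (.pi fun o : Option ι ↦ o.elim x z))).congr (.of_forall fun ω ↦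
        Prod.ext (funext fun _ ↦ ?_) (funext fun o ↦ ?_))
      · simp [R, U, V, A, B, u, v, x, y, z]
      · cases o <;> simp [XZ, x, z]
    have := hG.indepFun_of_covariance_eval fun _ o ↦ by cases o; exacts [hRX, hRZ _]
    have hev : Measurable fun f : Unit → ℝ ↦ f () := measurable_pi_apply ()
    exact this.comp hev (ψ := fun f ↦ (f none, fun i ↦ f (some i)))
      (by fun_prop)
  have hi {f : Ω → ℝ} (hf : MemLp f 2 P) : Integrable f P := hf.integrable one_le_two
  have hXZ := condExp_add_of_indepFun hZ (h := A)
    (Measurable.comp (g := fun z : ι → ℝ ↦ ∑ i, a i * z i) (by fun_prop) (comap_measurable Z))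
    (hi hA2) hUm (hi hU2)
    (hUVZ.comp measurable_fst measurable_id)
  have hYZ := condExp_add_of_indepFun hZ (h := B)
    (Measurable.comp (g := fun z : ι → ℝ ↦ ∑ i, b i * z i) (by fun_prop) (comap_measurable Z))
    (hi hB2) hVm (hi hV2)
    (hUVZ.comp measurable_snd measurable_id)
  have hYXZ := condExp_add_of_indepFun (hX.prodMk hZ) (h := fun ω ↦ B ω + β * U ω)
    (Measurable.comp
      (g := fun p : ℝ × (ι → ℝ) ↦ ∑ i, b i * p.2 i + β * (p.1 - ∑ i, a i * p.2 i))
      (by fun_prop) (comap_measurable _))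
    (hi (hB2.add (hU2.const_mul β))) hRm (hi hR2) hRXZ
  rw [show (fun ω ↦ A ω + U ω) = X by ext; simp [U]] at hXZ
  rw [show (fun ω ↦ B ω + V ω) = Y by ext; simp [V]] at hYZ
  rw [show (fun ω ↦ B ω + β * U ω + R ω) = Y by ext; simp [V, R]] at hYXZ
  have hconst {f : ℝ × ℝ → ℝ} (hf : Measurable f) :
      P[fun ω ↦ f (U ω, V ω) | MeasurableSpace.comap Z inferInstance]
        =ᵐ[P] fun _ ↦ ∫ ω, f (U ω, V ω) ∂P :=
    condExp_indep_eq (hf.comp (hUm.prodMk hVm)).comap_le hZ.comap_le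
      (comap_measurable _).stronglyMeasurable (hUVZ.comp hf measurable_id)
  have hvar : P[fun ω' => (X ω' - (P[X | MeasurableSpace.comap Z inferInstance]) ω') ^ 2 |
      MeasurableSpace.comap Z inferInstance] =ᵐ[P] fun _ ↦ Var[U; P] := by
    rw [variance_eq_integral hUm.aemeasurable]
    refine (condExp_congr_ae ?_).trans
      (hconst (f := fun p ↦ (p.1 - P[U]) ^ 2) (by fun_prop))
    filter_upwards [hXZ] with ω h1
    rw [h1]
    simp only [U]
    ring
  have hcov : P[fun ω' => (X ω' - (P[X | MeasurableSpace.comap Z inferInstance]) ω') *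
      (Y ω' - (P[Y | MeasurableSpace.comap Z inferInstance]) ω') |
      MeasurableSpace.comap Z inferInstance] =ᵐ[P] fun _ ↦ cov[U, V; P] := by
    refine (condExp_congr_ae ?_).trans
      (hconst (f := fun p ↦ (p.1 - P[U]) * (p.2 - P[V])) (by fun_prop))
    filter_upwards [hXZ, hYZ] with ω h1 h2
    rw [h1, h2]
    simp only [U, V]
    ring
  have hRint : P[R] = P[V] - β * P[U] := by
    simp only [R]
    rw [integral_sub (hi hV2) ((hi hU2).const_mul β), integral_const_mul]
  filter_upwards [hXZ, hYZ, hYXZ, hvar, hcov] with ω h1 h2 h3 h4 h5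
  rw [h4, h5, h1, h2, h3, hRint]
  have hgoal : B ω + β * U ω + (P[V] - β * P[U]) - (B ω + P[V]) = β * (X ω - (A ω + P[U])) := by
    simp only [U]
    ring
  rw [hgoal]
  split_ifs with hpos
  · rfl
  · have : Var[U; P] = 0 := le_antisymm (not_lt.1 hpos) (variance_nonneg _ _)
    simp [β, this]

end ProbabilityTheory

/-- **Corollary 2, "partial out" formula.** Let `n ≥ 3` and let `W = (X, Y, Z)`
be multivariate Normal on `ℝⁿ`, where `X, Y` are real-valued and `Z` takes values in `ℝⁿ⁻²`.
Then almost surely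
`E(Y | X, Z) − E(Y | Z) = (Cov(X, Y | Z) / Var(X | Z)) · 1[Var(X|Z) > 0] · (X − E(X | Z))`,
where `Cov(X, Y | Z) = E[(X − E(X|Z))(Y − E(Y|Z)) | Z]` and `Var(X | Z) = Cov(X, X | Z)`,
the right-hand side being `0` on the event `Var(X|Z) = 0`. -/
theorem partial_out_formula_normal
    {Ω : Type*} [mΩ : MeasurableSpace Ω] (P : Measure Ω) [IsProbabilityMeasure P]
    (n : ℕ) (hn : 3 ≤ n)
    (W : Ω → EuclideanSpace ℝ (Fin n)) (hWmeas : Measurable W)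
    (μ : EuclideanSpace ℝ (Fin n))
    (D : EuclideanSpace ℝ (Fin n) →ₗ[ℝ] EuclideanSpace ℝ (Fin n))
    (hDsym : LinearMap.IsSymmetric D) (hDpos : ∀ t, 0 ≤ ⟪D t, t⟫)
    (hW : ∀ t : EuclideanSpace ℝ (Fin n),
      ∫ ω, Complex.exp (⟪t, W ω⟫ * Complex.I) ∂P
        = Complex.exp (⟪t, μ⟫ * Complex.I - ⟪t, D t⟫ / 2))
    (X Y : Ω → ℝ) (Z : Ω → (Fin (n - 2) → ℝ))
    (hX : ∀ ω, X ω = W ω ⟨0, by omega⟩)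
    (hY : ∀ ω, Y ω = W ω ⟨1, by omega⟩)
    (hZ : ∀ ω (i : Fin (n - 2)), Z ω i = W ω ⟨(i : ℕ) + 2, by omega⟩)
    -- the σ-algebras generated by `Z` and by `(X, Z)`:
    (mZ mXZ : MeasurableSpace Ω)
    (hmZ : mZ = MeasurableSpace.comap Z (inferInstance : MeasurableSpace (Fin (n - 2) → ℝ)))
    (hmXZ : mXZ = MeasurableSpace.comap (fun ω => (X ω, Z ω))
        (inferInstance : MeasurableSpace (ℝ × (Fin (n - 2) → ℝ)))) :
    ∀ᵐ ω ∂P,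
      (P[Y | mXZ]) ω - (P[Y | mZ]) ω
        = if 0 < (P[fun ω' => (X ω' - (P[X | mZ]) ω') ^ 2 | mZ]) ω then
            ((P[fun ω' => (X ω' - (P[X | mZ]) ω') * (Y ω' - (P[Y | mZ]) ω') | mZ]) ω
                / (P[fun ω' => (X ω' - (P[X | mZ]) ω') ^ 2 | mZ]) ω)
              * (X ω - (P[X | mZ]) ω)
          else 0 := by
  subst hmZ hmXZ
  have hG := hasGaussianLaw_of_integral_cexp_eq hWmeas.aemeasurable μ D hDsym hDpos hW
  let w (i : Fin n) : EuclideanSpace ℝ (Fin n) →L[ℝ] ℝ := EuclideanSpace.proj i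
  have hWi (i : Fin n) : Measurable fun ω ↦ W ω i := (w i).measurable.comp hWmeas
  obtain rfl : X = fun ω ↦ W ω ⟨0, by omega⟩ := funext hX
  obtain rfl : Y = fun ω ↦ W ω ⟨1, by omega⟩ := funext hY
  obtain rfl : Z = fun ω (i : Fin (n - 2)) ↦ W ω ⟨(i : ℕ) + 2, by omega⟩ :=
    funext fun ω ↦ funext (hZ ω)
  have hXYZ := hG.map_fun ((w ⟨0, by omega⟩).prod ((w ⟨1, by omega⟩).prod
    (.pi fun i : Fin (n - 2) ↦ w ⟨(i : ℕ) + 2, by omega⟩)))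
  exact HasGaussianLaw.condExp_sub_condExp_ae_eq (hWi _) (hWi _)
    (measurable_pi_lambda _ fun _ ↦ hWi _) hXYZ _ _ rfl rfl
end
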